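/- Let Y be a symmetric positive definite g×g real matrix, ψ(x) = min_{m ∈ ℤ^g} ‖x - m‖_Y the distance from x to ℤ^g in the norm ‖·‖_Y, μ(Y) the covering radius, and F = [0,1]^g. Then ∫_F ψ(x)² dx ≥ μ(Y)²/3. -/

import Mathlib

open MeasureTheory Real Matrix

noncomputable def coeZ {g : ℕ} (m : Fin g → ℤ) : Fin g → ℝ := fun i => (m i : ℝ)

noncomputable def normY {g : ℕ} (Y : Matrix (Fin g) (Fin g) ℝ) (x : Fin g → ℝ) : ℝ :=
  Real.sqrt (x ⬝ᵥ Y.mulVec x)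

noncomputable def psi {g : ℕ} (Y : Matrix (Fin g) (Fin g) ℝ) (x : Fin g → ℝ) : ℝ :=
  ⨅ m : Fin g → ℤ, normY Y (x - coeZ m)

noncomputable def mu {g : ℕ} (Y : Matrix (Fin g) (Fin g) ℝ) : ℝ :=
  ⨆ x : Fin g → ℝ, psi Y x

noncomputable def lam1 {g : ℕ} (Y : Matrix (Fin g) (Fin g) ℝ) : ℝ :=
  ⨅ m : {m : Fin g → ℤ // m ≠ 0}, normY Y (coeZ (m : Fin g → ℤ))

noncomputable def cube (g : ℕ) : Set (Fin g → ℝ) := Set.univ.pi fun _ => Set.Icc (0:ℝ) 1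

lemma dotProduct_mulVec_nonneg_of_posDef {g : ℕ} {Y : Matrix (Fin g) (Fin g) ℝ} (hY : Y.PosDef)
    (x : Fin g → ℝ) : 0 ≤ x ⬝ᵥ Y.mulVec x := by
  simpa using hY.posSemidef.dotProduct_mulVec_nonneg x

lemma normY_sq {g : ℕ} {Y : Matrix (Fin g) (Fin g) ℝ} (hY : Y.PosDef) (x : Fin g → ℝ) :
    normY Y x ^ 2 = x ⬝ᵥ Y.mulVec x :=
  Real.sq_sqrt (dotProduct_mulVec_nonneg_of_posDef hY x)

lemma normY_nonneg {g : ℕ} (Y : Matrix (Fin g) (Fin g) ℝ) (x : Fin g → ℝ) : 0 ≤ normY Y x :=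
  Real.sqrt_nonneg _

lemma continuous_normY {g : ℕ} (Y : Matrix (Fin g) (Fin g) ℝ) : Continuous (normY Y) := by
  unfold normY
  fun_prop

lemma psi_nonneg {g : ℕ} (Y : Matrix (Fin g) (Fin g) ℝ) (x : Fin g → ℝ) : 0 ≤ psi Y x :=
  Real.iInf_nonneg fun _ => normY_nonneg _ _

lemma psi_le_normY {g : ℕ} (Y : Matrix (Fin g) (Fin g) ℝ) (x : Fin g → ℝ) (m : Fin g → ℤ) :
    psi Y x ≤ normY Y (x - coeZ m) :=
  ciInf_le ⟨0, by rintro _ ⟨m, rfl⟩; exact normY_nonneg _ _⟩ m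

lemma measurable_psi {g : ℕ} (Y : Matrix (Fin g) (Fin g) ℝ) : Measurable (psi Y) := by
  unfold psi
  exact Measurable.iInf fun m => ((continuous_normY Y).comp (by fun_prop)).measurable

lemma psi_add_coeZ {g : ℕ} (Y : Matrix (Fin g) (Fin g) ℝ) (x : Fin g → ℝ) (k : Fin g → ℤ) :
    psi Y (x + coeZ k) = psi Y x := by
  unfold psi
  refine (Equiv.iInf_congr (Equiv.addRight k) fun m => ?_).symm
  congr 1
  ext i
  simp [coeZ]

lemma le_psi_sq {g : ℕ} {Y : Matrix (Fin g) (Fin g) ℝ} {x : Fin g → ℝ} {c : ℝ}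
    (h : ∀ m, c ≤ normY Y (x - coeZ m) ^ 2) : c ≤ psi Y x ^ 2 :=
  (Real.sqrt_le_left (psi_nonneg Y x)).1 <|
    le_ciInf fun m => (Real.sqrt_le_left (normY_nonneg _ _)).2 (h m)

/-- The squared distance to the lattice satisfies one half of the parallelogram law. -/
lemma psi_sq_add_psi_sq_le {g : ℕ} {Y : Matrix (Fin g) (Fin g) ℝ} (hY : Y.PosDef)
    (x y : Fin g → ℝ) :
    psi Y (x + y) ^ 2 + psi Y (x - y) ^ 2 ≤ 2 * psi Y x ^ 2 + 2 * psi Y y ^ 2 := by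
  have key (a b : Fin g → ℤ) : psi Y (x + y) ^ 2 + psi Y (x - y) ^ 2 ≤
      2 * normY Y (x - coeZ a) ^ 2 + 2 * normY Y (y - coeZ b) ^ 2 := by
    have h₁ := pow_le_pow_left₀ (psi_nonneg Y _) (psi_le_normY Y (x + y) (a + b)) 2
    have h₂ := pow_le_pow_left₀ (psi_nonneg Y _) (psi_le_normY Y (x - y) (a - b)) 2
    have e₁ : x + y - coeZ (a + b) = (x - coeZ a) + (y - coeZ b) := by
      ext i; simp [coeZ]; ring
    have e₂ : x - y - coeZ (a - b) = (x - coeZ a) - (y - coeZ b) := by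
      ext i; simp [coeZ]; ring
    rw [e₁, normY_sq hY] at h₁
    rw [e₂, normY_sq hY] at h₂
    rw [normY_sq hY, normY_sq hY]
    simp only [mulVec_add, mulVec_sub, dotProduct_add, dotProduct_sub, add_dotProduct,
      sub_dotProduct] at h₁ h₂ ⊢
    linarith
  have hx (b : Fin g → ℤ) : (psi Y (x + y) ^ 2 + psi Y (x - y) ^ 2 -
      2 * normY Y (y - coeZ b) ^ 2) / 2 ≤ psi Y x ^ 2 :=
    le_psi_sq fun a => by linarith [key a b]
  have hy : (psi Y (x + y) ^ 2 + psi Y (x - y) ^ 2 - 2 * psi Y x ^ 2) / 2 ≤ psi Y y ^ 2 :=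
    le_psi_sq fun b => by linarith [hx b]
  linarith

/-- The function on the torus `ℝ^g / ℤ^g` induced by `psi Y ^ 2`. -/
noncomputable def torusPsiSq {g : ℕ} (Y : Matrix (Fin g) (Fin g) ℝ)
    (t : Fin g → UnitAddCircle) : ℝ :=
  psi Y (fun i => (AddCircle.equivIoc 1 0 (t i) : ℝ)) ^ 2

lemma torusPsiSq_coe {g : ℕ} (Y : Matrix (Fin g) (Fin g) ℝ) (x : Fin g → ℝ) :
    torusPsiSq Y (fun i => (x i : UnitAddCircle)) = psi Y x ^ 2 := by
  have h (i : Fin g) : ∃ k : ℤ,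
      (AddCircle.equivIoc 1 0 (x i : UnitAddCircle) : ℝ) = x i + k := by
    have h : ((AddCircle.equivIoc 1 0 (x i : UnitAddCircle) : ℝ) : UnitAddCircle) = x i :=
      (AddCircle.equivIoc 1 0).symm_apply_apply (x i : UnitAddCircle)
    rw [← sub_eq_zero, ← AddCircle.coe_sub, AddCircle.coe_eq_zero_iff] at h
    obtain ⟨k, hk⟩ := h
    exact ⟨k, by rw [zsmul_one] at hk; linarith⟩
  choose k hk using h
  rw [torusPsiSq, ← psi_add_coeZ Y x k]
  congr 2
  ext i
  simp [hk, coeZ]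

lemma measurable_torusPsiSq {g : ℕ} (Y : Matrix (Fin g) (Fin g) ℝ) :
    Measurable (torusPsiSq Y) := by
  refine ((measurable_psi Y).comp (measurable_pi_lambda _ fun i => ?_)).pow_const 2
  exact measurable_subtype_coe.comp
    ((AddCircle.measurableEquivIoc 1 0).measurable.comp (measurable_pi_apply i))

lemma integrable_torusPsiSq {g : ℕ} (Y : Matrix (Fin g) (Fin g) ℝ) :
    Integrable (torusPsiSq Y) := by
  have hc : IsCompact (cube g) := isCompact_univ_pi fun _ => isCompact_Icc
  obtain ⟨C, hC⟩ := hc.exists_bound_of_continuousOn (continuous_normY Y).continuousOn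
  refine Integrable.of_bound (measurable_torusPsiSq Y).aestronglyMeasurable (C ^ 2)
    (.of_forall fun t => ?_)
  rw [torusPsiSq, norm_pow, Real.norm_of_nonneg (psi_nonneg _ _)]
  refine pow_le_pow_left₀ (psi_nonneg _ _) ((psi_le_normY Y _ 0).trans ?_) 2
  have h0 : coeZ (0 : Fin g → ℤ) = 0 := by ext; simp [coeZ]
  rw [h0, sub_zero]
  refine (le_abs_self _).trans (hC _ fun i _ => ?_)
  have := (AddCircle.equivIoc (1 : ℝ) 0 (t i)).2
  exact ⟨this.1.le, by simpa using this.2⟩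

lemma setIntegral_cube_psi_sq {g : ℕ} (Y : Matrix (Fin g) (Fin g) ℝ) :
    ∫ x in cube g, psi Y x ^ 2 = ∫ t, torusPsiSq Y t := by
  have h : MeasurePreserving (fun (x : Fin g → ℝ) i => (x i : UnitAddCircle))
      (volume.restrict (cube g)) volume := by
    have := measurePreserving_pi (fun _ : Fin g => volume.restrict (Set.Ioc (0 : ℝ) (0 + 1)))
      (fun _ => volume) fun _ => UnitAddCircle.measurePreserving_mk 0
    rw [← Measure.restrict_pi_pi] at this
    rw [cube, volume_pi, Measure.restrict_congr_set Measure.pi_Ioc_ae_eq_pi_Icc.symm]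
    simpa [volume_pi] using this
  rw [← h.map_eq, integral_map h.aemeasurable (measurable_torusPsiSq Y).aestronglyMeasurable]
  simp only [torusPsiSq_coe]

lemma measurePreserving_unitAddTorus_add_self (g : ℕ) :
    MeasurePreserving (fun t : Fin g → UnitAddCircle => t + t) := by
  let f : (Fin g → UnitAddCircle) →+ (Fin g → UnitAddCircle) :=
    AddMonoidHom.id _ + AddMonoidHom.id _
  have hs : Function.Surjective f := fun t => by
    choose x hx using fun i => QuotientAddGroup.mk_surjective (t i)
    refine ⟨fun i => ((x i / 2 : ℝ) : UnitAddCircle), funext fun i => ?_⟩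
    rw [← hx i]
    change ((x i / 2 : ℝ) : UnitAddCircle) + ((x i / 2 : ℝ) : UnitAddCircle) = (x i : UnitAddCircle)
    rw [← AddCircle.coe_add, add_halves]
  exact f.measurePreserving (by change Continuous fun t => t + t; fun_prop) hs rfl

lemma psi_sq_div_three_le_integral {g : ℕ} {Y : Matrix (Fin g) (Fin g) ℝ} (hY : Y.PosDef)
    (v : Fin g → ℝ) : psi Y v ^ 2 / 3 ≤ ∫ x in cube g, psi Y x ^ 2 := by
  rw [setIntegral_cube_psi_sq]
  let w : Fin g → UnitAddCircle := fun i => (v i : UnitAddCircle)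
  have : (volume : Measure (Fin g → UnitAddCircle)).IsNegInvariant :=
    Measure.pi.isNegInvariant _
  have hF := integrable_torusPsiSq Y
  have hd := measurePreserving_unitAddTorus_add_self g
  have hF₁ : Integrable fun t => torusPsiSq Y (t + t - w) :=
    hd.integrable_comp_of_integrable (hF.comp_sub_right w)
  have hF₂ : Integrable fun t => torusPsiSq Y (w - t) := hF.comp_sub_left w
  have e₁ : ∫ t, torusPsiSq Y (t + t - w) = ∫ t, torusPsiSq Y t := by
    have hm : Measurable fun t => torusPsiSq Y (t - w) :=
      (measurable_torusPsiSq Y).comp (measurable_id.sub_const w)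
    rw [← integral_sub_right_eq_self (torusPsiSq Y) w]
    conv_rhs => rw [← hd.map_eq]
    rw [integral_map hd.aemeasurable hm.aestronglyMeasurable]
  have e₂ : ∫ t, torusPsiSq Y (w - t) = ∫ t, torusPsiSq Y t :=
    integral_sub_left_eq_self (torusPsiSq Y) volume w
  have pointwise (t : Fin g → UnitAddCircle) :
      psi Y v ^ 2 + torusPsiSq Y (t + t - w) ≤ 2 * torusPsiSq Y t + 2 * torusPsiSq Y (w - t) := by
    choose x hx using fun i => QuotientAddGroup.mk_surjective (t i)
    obtain rfl : (fun i => (x i : UnitAddCircle)) = t := funext hx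
    have h := psi_sq_add_psi_sq_le hY x (v - x)
    rw [add_sub_cancel, sub_sub_eq_add_sub, ← torusPsiSq_coe Y (x + x - v), ← torusPsiSq_coe Y (v - x),
      ← torusPsiSq_coe Y x] at h
    exact h
  have h := integral_mono ((integrable_const _).add hF₁)
    ((hF.const_mul 2).add (hF₂.const_mul 2)) pointwise
  simp only [Pi.add_apply] at h
  rw [integral_add (integrable_const _) hF₁, integral_add (hF.const_mul 2) (hF₂.const_mul 2),
    integral_const_mul, integral_const_mul, e₁, e₂] at h
  have hvol : volume.real (Set.univ : Set (Fin g → UnitAddCircle)) = 1 := by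
    simp [measureReal_def, volume_pi, Measure.pi_univ]
  rw [integral_const, hvol, one_smul] at h
  linarith

theorem integral_psi_sq_ge {g : ℕ} (Y : Matrix (Fin g) (Fin g) ℝ)
    (hsymm : Y.IsSymm) (hY : Y.PosDef) :
    mu Y ^ 2 / 3 ≤ ∫ x in cube g, psi Y x ^ 2 := by
  have h : mu Y ≤ √(3 * ∫ x in cube g, psi Y x ^ 2) :=
    ciSup_le fun v => Real.le_sqrt_of_sq_le (by linarith [psi_sq_div_three_le_integral hY v])
  have h0 : 0 ≤ mu Y := Real.iSup_nonneg fun v => psi_nonneg Y v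
  have hI : 0 ≤ ∫ x in cube g, psi Y x ^ 2 := integral_nonneg fun _ => sq_nonneg _
  have := (Real.le_sqrt h0 (by positivity)).1 h
  linarith
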